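/- Suppose α = ℙ(Y = 1) ≥ 1/2. Then for any measurable binary classifier f : 𝒳 → {0,1}, Acc(f) ≤ α + (1 − α) · d_TV(P₁, P₀). -/

import Mathlib

open MeasureTheory ProbabilityTheory

/-- Total variation distance between two measures: the supremum over measurable
sets `A` of `|P(A) - Q(A)|`. -/
noncomputable def dTV {𝒳 : Type*} [MeasurableSpace 𝒳] (P Q : Measure 𝒳) : ℝ :=
  ⨆ A : {A : Set 𝒳 // MeasurableSet A}, |(P A.1).toReal - (Q A.1).toReal|

/-- The discrepancy of two probability measures on a measurable set is at most their total
variation distance. -/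
theorem abs_measureReal_sub_le_dTV {𝒳 : Type*} [MeasurableSpace 𝒳] (P Q : Measure 𝒳)
    [IsProbabilityMeasure P] [IsProbabilityMeasure Q] {A : Set 𝒳} (hA : MeasurableSet A) :
    |P.real A - Q.real A| ≤ dTV P Q := by
  refine le_ciSup (f := fun A : {A : Set 𝒳 // MeasurableSet A} ↦ |P.real A.1 - Q.real A.1|)
    ⟨1, ?_⟩ ⟨A, hA⟩
  rintro _ ⟨B, rfl⟩
  exact abs_sub_le_iff.2
    ⟨by linarith [measureReal_le_one (μ := P) (s := B.1), measureReal_nonneg (μ := Q) (s := B.1)],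
      by linarith [measureReal_le_one (μ := Q) (s := B.1), measureReal_nonneg (μ := P) (s := B.1)]⟩

/-- The joint probability of an event and of `X ∈ A` as a product with the conditional law of
`X`. -/
theorem measureReal_inter_preimage_eq_mul_map_cond {Ω 𝒳 : Type*} [MeasurableSpace Ω]
    [MeasurableSpace 𝒳] (μ : Measure Ω) [IsFiniteMeasure μ] {X : Ω → 𝒳} (hX : Measurable X)
    {s : Set Ω} (hs : MeasurableSet s) {A : Set 𝒳} (hA : MeasurableSet A) :
    μ.real (s ∩ X ⁻¹' A) = μ.real s * ((μ[|s]).map X).real A := by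
  rw [map_measureReal_apply hX hA, measureReal_def, measureReal_def, measureReal_def,
    ← ENNReal.toReal_mul, mul_comm, cond_mul_eq_inter hs]

/-- If `α ≥ 1/2`, then `Acc(f) ≤ α + (1 − α) · d_TV(P₁, P₀)`. -/
theorem accuracy_upper_bound_alpha_ge_half
    {Ω 𝒳 : Type*} [MeasurableSpace Ω] [MeasurableSpace 𝒳]
    (Pr : Measure Ω) [IsProbabilityMeasure Pr]
    (X : Ω → 𝒳) (hX : Measurable X)
    (Y : Ω → Bool) (hY : Measurable Y)
    (α : ℝ) (hα : α = (Pr {ω | Y ω = true}).toReal)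
    (hα0 : 0 < α) (hα1 : α < 1)
    (hhalf : 1 / 2 ≤ α)
    (P₀ P₁ : Measure 𝒳)
    (hP₀ : P₀ = (Pr[|{ω | Y ω = false}]).map X)
    (hP₁ : P₁ = (Pr[|{ω | Y ω = true}]).map X)
    (f : 𝒳 → Bool) (hf : Measurable f)
    :
    (Pr {ω | f (X ω) = Y ω}).toReal ≤ α + (1 - α) * dTV P₁ P₀ := by
  have hT : MeasurableSet {ω | Y ω = true} := hY (measurableSet_singleton true)
  have hF : MeasurableSet {ω | Y ω = false} := hY (measurableSet_singleton false)
  have hA : MeasurableSet (f ⁻¹' {true}) := hf (measurableSet_singleton true)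
  change α = Pr.real {ω | Y ω = true} at hα
  have hcompl : {ω | Y ω = false} = {ω | Y ω = true}ᶜ := by ext; simp
  have hαF : Pr.real {ω | Y ω = false} = 1 - α := by
    rw [hcompl, probReal_compl_eq_one_sub hT, hα]
  have : IsProbabilityMeasure P₁ := by
    have := cond_isProbabilityMeasure (μ := Pr) (s := {ω | Y ω = true})
      (fun h ↦ by simp [measureReal_def, h] at hα; linarith)
    exact hP₁ ▸ Measure.isProbabilityMeasure_map hX.aemeasurable
  have : IsProbabilityMeasure P₀ := by
    have := cond_isProbabilityMeasure (μ := Pr) (s := {ω | Y ω = false})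
      (fun h ↦ by simp [measureReal_def, h] at hαF; linarith)
    exact hP₀ ▸ Measure.isProbabilityMeasure_map hX.aemeasurable
  have hacc : Pr.real {ω | f (X ω) = Y ω} =
      α * P₁.real (f ⁻¹' {true}) + (1 - α) * (1 - P₀.real (f ⁻¹' {true})) := by
    have hsplit : {ω | f (X ω) = Y ω} = ({ω | Y ω = true} ∩ X ⁻¹' (f ⁻¹' {true})) ∪
        ({ω | Y ω = false} ∩ X ⁻¹' (f ⁻¹' {true})ᶜ) := by
      ext ω
      cases h : Y ω <;> simp [h]
    have hdisj : Disjoint ({ω | Y ω = true} ∩ X ⁻¹' (f ⁻¹' {true}))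
        ({ω | Y ω = false} ∩ X ⁻¹' (f ⁻¹' {true})ᶜ) :=
      (hcompl ▸ disjoint_compl_right).mono Set.inter_subset_left Set.inter_subset_left
    rw [hsplit, measureReal_union hdisj (hF.inter (hX hA.compl)),
      measureReal_inter_preimage_eq_mul_map_cond Pr hX hT hA,
      measureReal_inter_preimage_eq_mul_map_cond Pr hX hF hA.compl,
      ← hP₀, ← hP₁, ← hα, hαF, probReal_compl_eq_one_sub hA]
  change Pr.real _ ≤ _
  rw [hacc]
  have hd := (le_abs_self _).trans (abs_measureReal_sub_le_dTV P₁ P₀ hA)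
  have hp := measureReal_le_one (μ := P₁) (s := f ⁻¹' {true})
  nlinarith [mul_le_mul_of_nonneg_left hd (sub_nonneg.2 hα1.le),
    mul_le_mul_of_nonneg_left hp (show 0 ≤ 2 * α - 1 by linarith)]
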